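/- arXiv:2604.13274 — 2 statements merged into one kernel-verified Lean document; each statement's English description precedes it below -/
import Mathlib

section
/- Let Δ ≥ 0 and let (a_t)_{t≥1} and (ã_t)_{t≥1} be real sequences such that there is a single index t₀ with |a_{t₀} − ã_{t₀}| ≤ Δ and a_t = ã_t for all t ≠ t₀. Define the CUSUM recursions S₀ = 0, S_t = max(0, S_{t−1} + a_t) and S̃₀ = 0, S̃_t = max(0, S̃_{t−1} + ã_t). Then |S_t − S̃_t| ≤ Δ for every t ≥ 0. -/
/-- CUSUM recursion with 1-based increments: `S 0 = 0`, `S (t+1) = max 0 (S t + a (t+1))`. -/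
def cusum (a : ℕ → ℝ) : ℕ → ℝ
  | 0 => 0
  | t + 1 => max 0 (cusum a t + a (t + 1))

/-- The CUSUM statistic is 1-Lipschitz in its increments with respect to the `ℓ¹` distance. -/
theorem abs_cusum_sub_cusum_le_sum (a a' : ℕ → ℝ) (t : ℕ) :
    |cusum a t - cusum a' t| ≤ ∑ s ∈ Finset.Icc 1 t, |a s - a' s| := by
  induction t with
  | zero => simp [cusum]
  | succ t ih =>
    rw [Finset.sum_Icc_succ_top (by lia)]
    calc |cusum a (t + 1) - cusum a' (t + 1)|
        ≤ |(cusum a t + a (t + 1)) - (cusum a' t + a' (t + 1))| := by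
          simpa only [cusum, max_comm (0 : ℝ)] using abs_max_sub_max_le_abs _ _ (0 : ℝ)
      _ ≤ |cusum a t - cusum a' t| + |a (t + 1) - a' (t + 1)| := by
          rw [add_sub_add_comm]
          exact abs_add_le _ _
      _ ≤ (∑ s ∈ Finset.Icc 1 t, |a s - a' s|) + |a (t + 1) - a' (t + 1)| := by gcongr

/-- per-stream sensitivity of the CUSUM statistic. If two increment
sequences agree except at a single index `t₀` where they differ by at most `Δ`, then the
corresponding CUSUM statistics differ by at most `Δ` at every time. -/
theorem cusum_sensitivity (Δ : ℝ) (hΔ : 0 ≤ Δ) (a a' : ℕ → ℝ) (t₀ : ℕ) (ht₀ : 1 ≤ t₀)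
    (hdiff : |a t₀ - a' t₀| ≤ Δ) (hagree : ∀ t, t ≠ t₀ → a t = a' t) :
    ∀ t, |cusum a t - cusum a' t| ≤ Δ := by
  intro t
  have hterm : ∀ s, |a s - a' s| = if s = t₀ then |a t₀ - a' t₀| else 0 := by
    intro s
    split_ifs with hs
    · rw [hs]
    · simp [hagree s hs]
  refine (abs_cusum_sub_cusum_le_sum a a' t).trans ?_
  rw [Finset.sum_congr rfl fun s _ => hterm s, Finset.sum_ite_eq']
  split_ifs
  · exact hdiff
  · exact hΔ
end

section
/- Let K ≥ 1, and for each stream k = 1,…,K let (a^k_t)_{t≥1} and (ã^k_t)_{t≥1} be real sequences such that there is a single pair (k₀, t₀) with |a^{k₀}_{t₀} − ã^{k₀}_{t₀}| ≤ Δ_max and a^k_t = ã^k_t for all other pairs (k, t). Define per-stream CUSUM recursions S^k₀ = 0, S^k_t = max(0, S^k_{t−1} + a^k_t) (and S̃^k_t analogously from ã), and set U_t = Σ_{k=1}^K S^k_t, Ũ_t = Σ_{k=1}^K S̃^k_t. Then |U_t − Ũ_t| ≤ Δ_max for every t ≥ 0. -/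
/-- The CUSUM recursion is nonexpansive: the statistics of two sequences at time `t` differ by at
most the `ℓ¹` distance of the increments up to time `t`. -/
theorem abs_cusum_sub_cusum_le (a b : ℕ → ℝ) (t : ℕ) :
    |cusum a t - cusum b t| ≤ ∑ s ∈ Finset.Icc 1 t, |a s - b s| := by
  induction t with
  | zero => simp [cusum]
  | succ t ih =>
    rw [Finset.sum_Icc_succ_top (by omega)]
    calc |cusum a (t + 1) - cusum b (t + 1)|
        ≤ |(cusum a t + a (t + 1)) - (cusum b t + b (t + 1))| := by
          simpa [cusum, max_comm] using
            abs_max_sub_max_le_abs (cusum a t + a (t + 1)) (cusum b t + b (t + 1)) 0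
      _ ≤ |cusum a t - cusum b t| + |a (t + 1) - b (t + 1)| := by
          rw [add_sub_add_comm]
          exact abs_add_le _ _
      _ ≤ _ := by gcongr

/-- sensitivity of the summed multi-stream CUSUM statistic. If two
multi-stream increment arrays agree except at a single pair `(k₀, t₀)` where they differ
by at most `Δmax`, then the sums of the per-stream CUSUM statistics differ by at most
`Δmax` at every time. -/
theorem sum_cusum_sensitivity (Δmax : ℝ) (hΔ : 0 ≤ Δmax) (K : ℕ) (hK : 1 ≤ K)
    (a a' : Fin K → ℕ → ℝ) (k₀ : Fin K) (t₀ : ℕ) (ht₀ : 1 ≤ t₀)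
    (hdiff : |a k₀ t₀ - a' k₀ t₀| ≤ Δmax)
    (hagree : ∀ k t, (k, t) ≠ (k₀, t₀) → a k t = a' k t) :
    ∀ t, |(∑ k, cusum (a k) t) - ∑ k, cusum (a' k) t| ≤ Δmax := by
  intro t
  have hother : ∀ k, k ≠ k₀ → a k = a' k := fun k hk =>
    funext fun s => hagree k s (by simp [hk])
  rw [← Finset.sum_sub_distrib, Finset.sum_eq_single k₀
    (fun k _ hk => by rw [hother k hk, sub_self]) (by simp)]
  calc |cusum (a k₀) t - cusum (a' k₀) t|
      ≤ ∑ s ∈ Finset.Icc 1 t, |a k₀ s - a' k₀ s| := abs_cusum_sub_cusum_le _ _ t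
    _ ≤ ∑ s ∈ Finset.Icc 1 t, if s = t₀ then Δmax else 0 := by
        refine Finset.sum_le_sum fun s _ => ?_
        split_ifs with hs
        · rwa [hs]
        · simp [hagree k₀ s (by simp [hs])]
    _ ≤ Δmax := by
        rw [Finset.sum_ite_eq']
        split_ifs
        · exact le_rfl
        · exact hΔ
end
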